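/- Let D ⊆ ℝ² be open and let F : D → SU(2) and A, B, θ, ρ : D → ℝ be smooth maps satisfying the frame equations F⁻¹·∂ᵤF = -(∂ᵤθ/2)·e₃ + ((ρ-1)/2)·A·ξ₁(θ) and F⁻¹·∂ᵥF = (∂ᵥθ/2)·e₃ - ((ρ+1)/2)·B·ξ₂(θ) on D. Define the normal Gauss map ν = F·e₃·F⁻¹. Then at each point p ∈ D, the mixed partial derivative ∂ᵤ∂ᵥν(p) is a real scalar multiple of ν(p) if and only if ∂ᵤ(B·(ρ+1))(p) = 0. -/

import Mathlib

open Matrix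

attribute [local instance] Matrix.frobeniusNormedAddCommGroup Matrix.frobeniusNormedSpace

noncomputable section

/-- Basis of su(2). -/
def e1 : Matrix (Fin 2) (Fin 2) ℂ := !![0, 1; -1, 0]
def e2 : Matrix (Fin 2) (Fin 2) ℂ := !![0, Complex.I; Complex.I, 0]
def e3 : Matrix (Fin 2) (Fin 2) ℂ := !![Complex.I, 0; 0, -Complex.I]

def xi1 (θ : ℝ) : Matrix (Fin 2) (Fin 2) ℂ := Real.cos θ • e1 - Real.sin θ • e2
def xi2 (θ : ℝ) : Matrix (Fin 2) (Fin 2) ℂ := Real.cos θ • e1 + Real.sin θ • e2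

/-- Partial derivative in the `u` direction. -/
def pu {E : Type*} [NormedAddCommGroup E] [NormedSpace ℝ E]
    (f : ℝ × ℝ → E) (p : ℝ × ℝ) : E := fderiv ℝ f p (1, 0)

/-- Partial derivative in the `v` direction. -/
def pv {E : Type*} [NormedAddCommGroup E] [NormedSpace ℝ E]
    (f : ℝ × ℝ → E) (p : ℝ × ℝ) : E := fderiv ℝ f p (0, 1)

/-- The normal Gauss map `ν = F·e₃·F⁻¹`. -/
def nu (F : ℝ × ℝ → Matrix (Fin 2) (Fin 2) ℂ) (p : ℝ × ℝ) : Matrix (Fin 2) (Fin 2) ℂ :=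
  F p * e3 * (F p)⁻¹

/-- The derivative of a conjugate `f·m·f⁻¹`, expressed in the moving frame `f`. -/
theorem fderiv_mul_mul_ringInverse {E R : Type*} [NormedAddCommGroup E] [NormedSpace ℝ E]
    [NormedRing R] [HasSummableGeomSeries R] [NormedAlgebra ℝ R] {f m : E → R} {x : E}
    (hf : DifferentiableAt ℝ f x) (hm : DifferentiableAt ℝ m x) (hx : IsUnit (f x)) (w : E) :
    fderiv ℝ (fun y => f y * m y * Ring.inverse (f y)) x w
      = f x * (fderiv ℝ m x w
          + (Ring.inverse (f x) * fderiv ℝ f x w * m x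
            - m x * (Ring.inverse (f x) * fderiv ℝ f x w))) * Ring.inverse (f x) := by
  obtain ⟨U, hU⟩ := hx
  have hinv : HasFDerivAt Ring.inverse (-ContinuousLinearMap.mulLeftRight ℝ R ↑U⁻¹ ↑U⁻¹) (f x) :=
    hU ▸ hasFDerivAt_ringInverse U
  have h := (hf.hasFDerivAt.mul' hm.hasFDerivAt).mul' (hinv.comp x hf.hasFDerivAt)
  have hcomp : HasFDerivAt (fun y => f y * m y * Ring.inverse (f y)) _ x := h
  rw [hcomp.fderiv]
  have h1 : (U : R) * ((U⁻¹ : Rˣ) : R) = 1 := U.mul_inv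
  simp [← hU, mul_add, add_mul, mul_sub, sub_mul, ← mul_assoc, h1]
  abel

theorem fderiv_mul_mul_inv {E : Type*} [NormedAddCommGroup E] [NormedSpace ℝ E]
    {f m : E → Matrix (Fin 2) (Fin 2) ℂ} {x : E}
    (hf : DifferentiableAt ℝ f x) (hm : DifferentiableAt ℝ m x) (hx : IsUnit (f x)) (w : E) :
    fderiv ℝ (fun y => f y * m y * (f y)⁻¹) x w
      = f x * (fderiv ℝ m x w
          + ((f x)⁻¹ * fderiv ℝ f x w * m x - m x * ((f x)⁻¹ * fderiv ℝ f x w))) * (f x)⁻¹ := by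
  let := Matrix.frobeniusNormedRing (m := Fin 2) (α := ℂ)
  let := Matrix.frobeniusNormedAlgebra (m := Fin 2) (R := ℝ) (α := ℂ)
  simp only [Matrix.nonsing_inv_eq_ringInverse]
  exact fderiv_mul_mul_ringInverse hf hm hx w

theorem fderiv_smul_comp {E G : Type*} [NormedAddCommGroup E] [NormedSpace ℝ E]
    [NormedAddCommGroup G] [NormedSpace ℝ G] {b θ : E → ℝ} {g : ℝ → G} {g' : G} {x : E}
    (hb : DifferentiableAt ℝ b x) (hθ : DifferentiableAt ℝ θ x) (hg : HasDerivAt g g' (θ x))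
    (w : E) :
    fderiv ℝ (fun y => b y • g (θ y)) x w
      = fderiv ℝ b x w • g (θ x) + (b x * fderiv ℝ θ x w) • g' := by
  have h : HasFDerivAt (fun y => b y • g (θ y)) _ x :=
    hb.hasFDerivAt.smul (hg.hasFDerivAt.comp x hθ.hasFDerivAt)
  rw [h.fderiv]
  simp [mul_smul, add_comm]

/-- The direction of `∂ᵥν` in the moving frame. -/
def eta (t : ℝ) : Matrix (Fin 2) (Fin 2) ℂ := Real.cos t • e2 - Real.sin t • e1

theorem hasDerivAt_eta (t : ℝ) : HasDerivAt eta (-xi2 t) t := by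
  have h := ((Real.hasDerivAt_cos t).smul_const e2).sub ((Real.hasDerivAt_sin t).smul_const e1)
  refine HasDerivAt.congr_deriv h ?_
  simp only [xi2]
  module

theorem commutator_e3_of_frame (a b t : ℝ) :
    (a • e3 - (b / 2) • xi2 t) * e3 - e3 * (a • e3 - (b / 2) • xi2 t) = b • eta t := by
  simp only [xi2, eta, e1, e2, e3]
  generalize Real.cos t = c, Real.sin t = s
  ext i j
  fin_cases i <;> fin_cases j <;>
    simp [Complex.ext_iff] <;> constructor <;> ring

theorem commutator_eta_of_frame (w a b t : ℝ) :
    ((-w / 2) • e3 + a • xi1 t) * (b • eta t) - (b • eta t) * ((-w / 2) • e3 + a • xi1 t)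
      = (b * w) • xi2 t + (2 * a * b * Real.cos (2 * t)) • e3 := by
  simp only [Real.cos_two_mul', xi1, xi2, eta, e1, e2, e3]
  generalize Real.cos t = c, Real.sin t = s
  ext i j
  fin_cases i <;> fin_cases j <;>
    simp [Complex.ext_iff, pow_two] <;> constructor <;> ring

theorem smul_eta_add_smul_e3_eq_iff (c d k t : ℝ) :
    c • eta t + d • e3 = k • e3 ↔ c = 0 ∧ d = k := by
  refine ⟨fun h => ?_, fun ⟨hc, hd⟩ => by simp [hc, hd]⟩
  have h00 := congrArg Complex.im (congrFun (congrFun h 0) 0)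
  have h01r := congrArg Complex.re (congrFun (congrFun h 0) 1)
  have h01i := congrArg Complex.im (congrFun (congrFun h 0) 1)
  simp [eta, e1, e2, e3, -Complex.ofReal_cos, -Complex.ofReal_sin] at h00 h01r h01i
  refine ⟨?_, h00⟩
  have := Real.sin_sq_add_cos_sq t
  rcases h01r with h | h
  · exact h
  · rcases h01i with h' | h'
    · exact h'
    · simp [h, h'] at this

theorem harmonicity_vu_iff
    (D : Set (ℝ × ℝ)) (hD : IsOpen D)
    (F : ℝ × ℝ → Matrix (Fin 2) (Fin 2) ℂ) (A B θ ρ : ℝ × ℝ → ℝ)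
    (hF : ContDiffOn ℝ (⊤ : ℕ∞) F D) (hA : ContDiffOn ℝ (⊤ : ℕ∞) A D) (hB : ContDiffOn ℝ (⊤ : ℕ∞) B D)
    (hθ : ContDiffOn ℝ (⊤ : ℕ∞) θ D) (hρ : ContDiffOn ℝ (⊤ : ℕ∞) ρ D)
    (hSU : ∀ p ∈ D, F p ∈ Matrix.specialUnitaryGroup (Fin 2) ℂ)
    (hu : ∀ p ∈ D, (F p)⁻¹ * pu F p
        = (-(pu θ p) / 2) • e3 + ((ρ p - 1) / 2 * A p) • xi1 (θ p))
    (hv : ∀ p ∈ D, (F p)⁻¹ * pv F p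
        = (pv θ p / 2) • e3 - ((ρ p + 1) / 2 * B p) • xi2 (θ p))
    (p : ℝ × ℝ) (hp : p ∈ D) :
    (∃ k : ℝ, pu (pv (nu F)) p = k • nu F p) ↔
      pu (fun q => B q * (ρ q + 1)) p = 0 := by
  have hnhds : D ∈ nhds p := hD.mem_nhds hp
  have hdiff : ∀ {G : Type} [NormedAddCommGroup G] [NormedSpace ℝ G] {f : ℝ × ℝ → G},
      ContDiffOn ℝ (⊤ : ℕ∞) f D → ∀ q ∈ D, DifferentiableAt ℝ f q := fun hf q hq =>
    (hf.contDiffAt (hD.mem_nhds hq)).differentiableAt (by simp)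
  have hunit : ∀ q ∈ D, IsUnit (F q) := fun q hq =>
    (Matrix.isUnit_iff_isUnit_det _).2 (by
      rw [(Matrix.mem_specialUnitaryGroup_iff.1 (hSU q hq)).2]; exact isUnit_one)
  set b : ℝ × ℝ → ℝ := fun q => B q * (ρ q + 1) with hb
  have hpv : ∀ q ∈ D, pv (nu F) q = F q * (b q • eta (θ q)) * (F q)⁻¹ := by
    intro q hq
    have hconj := fderiv_mul_mul_inv (hdiff hF q hq) (differentiableAt_const e3) (hunit q hq) (0, 1)
    have hframe : (F q)⁻¹ * fderiv ℝ F q (0, 1) = (pv θ q / 2) • e3 - (b q / 2) • xi2 (θ q) := by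
      rw [show b q / 2 = (ρ q + 1) / 2 * B q by simp only [hb]; ring]
      exact hv q hq
    rw [hframe, commutator_e3_of_frame] at hconj
    rw [fderiv_fun_const, Pi.zero_apply, _root_.zero_apply, zero_add] at hconj
    exact hconj
  have hbp : DifferentiableAt ℝ b p := (hdiff hB p hp).mul ((hdiff hρ p hp).add_const 1)
  have hm := hbp.smul ((hasDerivAt_eta (θ p)).differentiableAt.comp p (hdiff hθ p hp))
  have hmu : fderiv ℝ (fun q => b q • eta (θ q)) p (1, 0)
      = pu b p • eta (θ p) + (b p * pu θ p) • -xi2 (θ p) :=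
    fderiv_smul_comp hbp (hdiff hθ p hp) (hasDerivAt_eta (θ p)) (1, 0)
  have hconj := fderiv_mul_mul_inv (hdiff hF p hp) hm (hunit p hp) (1, 0)
  have hframe : (F p)⁻¹ * fderiv ℝ F p (1, 0)
      = (-(pu θ p) / 2) • e3 + ((ρ p - 1) / 2 * A p) • xi1 (θ p) := hu p hp
  change fderiv ℝ (fun q => F q * (b q • eta (θ q)) * (F q)⁻¹) p (1, 0)
    = F p * (fderiv ℝ (fun q => b q • eta (θ q)) p (1, 0) + (_ * (b p • eta (θ p))
      - (b p • eta (θ p)) * _)) * (F p)⁻¹ at hconj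
  rw [hframe, commutator_eta_of_frame, hmu, smul_neg, ← sub_eq_add_neg, ← add_assoc, sub_add_cancel] at hconj
  rw [← (Filter.eventuallyEq_of_mem hnhds hpv).fderiv_eq] at hconj
  have hscalar : ∀ k : ℝ, k • nu F p = F p * (k • e3) * (F p)⁻¹ := fun k => by simp [nu]
  have hinv : IsUnit (F p)⁻¹ := (Matrix.isUnit_nonsing_inv_iff).2 (hunit p hp)
  simp only [show pu (pv (nu F)) p = _ from hconj, hscalar, hinv.mul_left_inj, (hunit p hp).mul_right_inj,
    smul_eta_add_smul_e3_eq_iff, exists_and_left, exists_eq', and_true]
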